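/- arXiv:2005.13536 — 2 statements merged into one kernel-verified Lean document; each statement's English description precedes it below -/
import Mathlib

section
/- Let (A, ≺_A, ≻_A) be a finite-dimensional pre-anti-flexible algebra over a field F of characteristic 0 and suppose its dual space A* carries a pre-anti-flexible algebra structure (≺_{A*}, ≻_{A*}). Write x·y = x≺_A y + x≻_A y and a∘b = a≺_{A*} b + a≻_{A*} b, and let L, R (resp. L', R') denote the multiplication operators on A (resp. A*), with * denoting dual maps. Then the following are equivalent: (1) the product (x+a) ⋆ (y+b) := (x·y + R'*_{≺_{A*}}(a)y + L'*_{≻_{A*}}(b)x) + (a∘b + R*_{≺_A}(x)b + L*_{≻_A}(y)a) makes A ⊕ A* an anti-flexible algebra; (2) the products (x+a) ≺ (y+b) := (x≺_A y − R'*_{≻_{A*}}(a)y + L'*_{∘}(b)x) + (a≺_{A*} b − R*_{≻_A}(x)b + L*_{·}(y)a) and (x+a) ≻ (y+b) := (x≻_A y + R'*_{∘}(a)y − L'*_{≺_{A*}}(b)x) + (a≻_{A*} b + R*_{·}(x)b − L*_{≺_A}(y)a) make A ⊕ A* a pre-anti-flexible algebra, where L· , R· are the multiplication operators of the product · on A and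 L'∘, R'∘ those of ∘ on A*. -/
/-- Anti-flexible algebra structure on a bilinear product. -/
def IsAntiFlexible {F A : Type*} [Field F] [AddCommGroup A] [Module F A]
    (m : A →ₗ[F] A →ₗ[F] A) : Prop :=
  ∀ x y z : A, m (m x y) z - m x (m y z) = m (m z y) x - m z (m y x)

/-- Pre-anti-flexible algebra structure on a pair of bilinear products `(≺, ≻) = (p, s)`. -/
def IsPreAntiFlexible {F A : Type*} [Field F] [AddCommGroup A] [Module F A]
    (p s : A →ₗ[F] A →ₗ[F] A) : Prop :=
  (∀ x y z : A, p (s x y) z - s x (p y z) = p (s z y) x - s z (p y x)) ∧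
  (∀ x y z : A, s (p x y + s x y) z - s x (s y z) = p (p z y) x - p z (p y x + s y x))

/-- Transfer an endomorphism of `Dual F A` to an endomorphism of `A` by dualizing and
identifying `A** ≅ A`: it satisfies `b (f° x) = (f b) x`. -/
noncomputable def dualEndOnBase {F A : Type*} [Field F] [AddCommGroup A] [Module F A]
    [FiniteDimensional F A] (f : Module.End F (Module.Dual F A)) : Module.End F A :=
  ((Module.evalEquiv F A).symm.conj :
      Module.End F (Module.Dual F (Module.Dual F A)) ≃ₗ[F] Module.End F A)
    (Module.Dual.transpose (R := F) f)

/-- The product `⋆` on `A ⊕ A*`: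
`(x+a) ⋆ (y+b) = (x·y + R'*≺(a)y + L'*≻(b)x) + (a∘b + R*≺(x)b + L*≻(y)a)`. -/
noncomputable def starProd {F A : Type*} [Field F] [AddCommGroup A] [Module F A]
    [FiniteDimensional F A] (p s : A →ₗ[F] A →ₗ[F] A)
    (p' s' : Module.Dual F A →ₗ[F] Module.Dual F A →ₗ[F] Module.Dual F A) :
    (A × Module.Dual F A) →ₗ[F] (A × Module.Dual F A) →ₗ[F] (A × Module.Dual F A) :=
  LinearMap.mk₂ F
    (fun z w =>
      (p z.1 w.1 + s z.1 w.1 + dualEndOnBase (p'.flip z.2) w.1 + dualEndOnBase (s' w.2) z.1,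
       p' z.2 w.2 + s' z.2 w.2 + Module.Dual.transpose (R := F) (p.flip z.1) w.2
         + Module.Dual.transpose (R := F) (s w.1) z.2))
    (by intro z z' w; simp [Prod.ext_iff, dualEndOnBase, map_add]; constructor <;> abel)
    (by intro c z w; simp [Prod.ext_iff, dualEndOnBase, map_smul, smul_add])
    (by intro z w w'; simp [Prod.ext_iff, dualEndOnBase, map_add]; constructor <;> abel)
    (by intro c z w; simp [Prod.ext_iff, dualEndOnBase, map_smul, smul_add])

/-- The product `≺` on `A ⊕ A*` of the matched pair of pre-anti-flexible algebras:
`(x+a) ≺ (y+b) = (x ≺_A y − R'*≻(a)y + L'*∘(b)x) + (a ≺_{A*} b − R*≻(x)b + L*·(y)a)`. -/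
noncomputable def matchedPrec {F A : Type*} [Field F] [AddCommGroup A] [Module F A]
    [FiniteDimensional F A] (p s : A →ₗ[F] A →ₗ[F] A)
    (p' s' : Module.Dual F A →ₗ[F] Module.Dual F A →ₗ[F] Module.Dual F A) :
    (A × Module.Dual F A) →ₗ[F] (A × Module.Dual F A) →ₗ[F] (A × Module.Dual F A) :=
  LinearMap.mk₂ F
    (fun z w =>
      (p z.1 w.1 - dualEndOnBase (s'.flip z.2) w.1 + dualEndOnBase ((p' + s') w.2) z.1,
       p' z.2 w.2 - Module.Dual.transpose (R := F) (s.flip z.1) w.2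
         + Module.Dual.transpose (R := F) ((p + s) w.1) z.2))
    (by intro z z' w; simp [Prod.ext_iff, dualEndOnBase, map_add]; constructor <;> abel)
    (by intro c z w; simp [Prod.ext_iff, dualEndOnBase, map_smul, smul_add, smul_sub])
    (by intro z w w'; simp [Prod.ext_iff, dualEndOnBase, map_add]; constructor <;> abel)
    (by intro c z w; simp [Prod.ext_iff, dualEndOnBase, map_smul, smul_add, smul_sub])

/-- The product `≻` on `A ⊕ A*` of the matched pair of pre-anti-flexible algebras:
`(x+a) ≻ (y+b) = (x ≻_A y + R'*∘(a)y − L'*≺(b)x) + (a ≻_{A*} b + R*·(x)b − L*≺(y)a)`. -/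
noncomputable def matchedSucc {F A : Type*} [Field F] [AddCommGroup A] [Module F A]
    [FiniteDimensional F A] (p s : A →ₗ[F] A →ₗ[F] A)
    (p' s' : Module.Dual F A →ₗ[F] Module.Dual F A →ₗ[F] Module.Dual F A) :
    (A × Module.Dual F A) →ₗ[F] (A × Module.Dual F A) →ₗ[F] (A × Module.Dual F A) :=
  LinearMap.mk₂ F
    (fun z w =>
      (s z.1 w.1 + dualEndOnBase ((p'.flip + s'.flip) z.2) w.1 - dualEndOnBase (p' w.2) z.1,
       s' z.2 w.2 + Module.Dual.transpose (R := F) ((p.flip + s.flip) z.1) w.2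
         - Module.Dual.transpose (R := F) (p w.1) z.2))
    (by intro z z' w; simp [Prod.ext_iff, dualEndOnBase, map_add]; constructor <;> abel)
    (by intro c z w; simp [Prod.ext_iff, dualEndOnBase, map_smul, smul_add, smul_sub])
    (by intro z w w'; simp [Prod.ext_iff, dualEndOnBase, map_add]; constructor <;> abel)
    (by intro c z w; simp [Prod.ext_iff, dualEndOnBase, map_smul, smul_add, smul_sub])

/-- The sum of the two products of a pre-anti-flexible algebra is anti-flexible. -/
theorem IsPreAntiFlexible.isAntiFlexible_add {F A : Type*} [Field F] [AddCommGroup A] [Module F A]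
    {p s : A →ₗ[F] A →ₗ[F] A} (h : IsPreAntiFlexible p s) : IsAntiFlexible (p + s) := by
  intro x y z
  have h₁ := h.1 x y z
  have h₂ := h.2 x y z
  have h₃ := h.2 z y x
  simp only [LinearMap.add_apply, map_add] at *
  linear_combination (norm := abel) h₁ + h₂ - h₃

/-- If `p` and `s` are adjoint to an anti-flexible product `m` with respect to a separating
bilinear form `ω` and sum to `m`, then they form a pre-anti-flexible algebra. -/
theorem IsAntiFlexible.isPreAntiFlexible_of_adjoint {F A : Type*} [Field F] [AddCommGroup A]
    [Module F A] {m p s : A →ₗ[F] A →ₗ[F] A} (hm : IsAntiFlexible m) (hadd : p + s = m)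
    (ω : A →ₗ[F] A →ₗ[F] F) (hω : ω.SeparatingLeft)
    (hp : ∀ u v w, ω (p u v) w = ω u (m v w)) (hs : ∀ u v w, ω (s u v) w = ω v (m w u)) :
    IsPreAntiFlexible p s := by
  have hadd' (x y : A) : p x y + s x y = m x y := by simp [← hadd]
  have hinj {u v : A} (h : ∀ w, ω u w = ω v w) : u = v :=
    sub_eq_zero.mp (hω _ fun w => by simp [h w])
  refine ⟨fun x y z => hinj fun w => ?_, fun x y z => hinj fun w => ?_⟩
  · have h := congrArg (ω y) (hm z w x)
    simp only [map_sub, LinearMap.sub_apply, hp, hs] at h ⊢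
    exact h
  · have h := congrArg (ω z) (hm w x y)
    simp only [hadd', map_sub, LinearMap.sub_apply, hp, hs] at h ⊢
    linear_combination -h

section Pairing

variable {F A : Type*} [Field F] [AddCommGroup A] [Module F A]

/-- The canonical skew-symmetric form on `A ⊕ A*`: `ω(x + a, y + b) = a(y) - b(x)`. -/
def dualPairing (F A : Type*) [Field F] [AddCommGroup A] [Module F A] :
    (A × Module.Dual F A) →ₗ[F] (A × Module.Dual F A) →ₗ[F] F :=
  LinearMap.mk₂ F (fun z w => z.2 w.1 - w.2 z.1)
    (by intro z z' w; simp; ring)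
    (by intro c z w; simp; ring)
    (by intro z w w'; simp; ring)
    (by intro c z w; simp; ring)

theorem dualPairing_apply (z w : A × Module.Dual F A) :
    dualPairing F A z w = z.2 w.1 - w.2 z.1 := rfl

theorem dualPairing_separatingLeft : (dualPairing F A).SeparatingLeft := by
  rintro ⟨x, a⟩ h
  refine Prod.ext ?_ (LinearMap.ext fun y => ?_)
  · exact (Module.forall_dual_apply_eq_zero_iff F x).mp fun b => by
      simpa [dualPairing_apply] using h (0, b)
  · simpa [dualPairing_apply] using h (y, 0)

variable [FiniteDimensional F A]

theorem apply_dualEndOnBase (f : Module.End F (Module.Dual F A)) (b : Module.Dual F A) (x : A) :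
    b (dualEndOnBase f x) = f b x := by
  simp [dualEndOnBase, LinearEquiv.conj_apply, Module.Dual.transpose]

theorem dualEndOnBase_add (f g : Module.End F (Module.Dual F A)) :
    dualEndOnBase (f + g) = dualEndOnBase f + dualEndOnBase g := by
  simp [dualEndOnBase]

variable (p s : A →ₗ[F] A →ₗ[F] A)
  (p' s' : Module.Dual F A →ₗ[F] Module.Dual F A →ₗ[F] Module.Dual F A)

theorem matchedPrec_add_matchedSucc :
    matchedPrec p s p' s' + matchedSucc p s p' s' = starProd p s p' s' := by
  refine LinearMap.ext₂ fun z w => Prod.ext ?_ ?_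
  · simp [matchedPrec, matchedSucc, starProd, dualEndOnBase_add]
    abel
  · simp [matchedPrec, matchedSucc, starProd]
    abel

theorem dualPairing_matchedPrec (u v w : A × Module.Dual F A) :
    dualPairing F A (matchedPrec p s p' s' u v) w = dualPairing F A u (starProd p s p' s' v w) := by
  simp [dualPairing_apply, matchedPrec, starProd, apply_dualEndOnBase, Module.Dual.transpose]
  ring

theorem dualPairing_matchedSucc (u v w : A × Module.Dual F A) :
    dualPairing F A (matchedSucc p s p' s' u v) w = dualPairing F A v (starProd p s p' s' w u) := by
  simp [dualPairing_apply, matchedSucc, starProd, apply_dualEndOnBase, Module.Dual.transpose]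
  ring

end Pairing

/-- `⋆` makes `A ⊕ A*` an anti-flexible algebra iff the matched-pair
products make `A ⊕ A*` a pre-anti-flexible algebra. -/
theorem starProd_antiFlexible_iff_matchedPair_preAntiFlexible
    {F A : Type*} [Field F] [CharZero F] [AddCommGroup A] [Module F A]
    [FiniteDimensional F A]
    (p s : A →ₗ[F] A →ₗ[F] A) (hA : IsPreAntiFlexible p s)
    (p' s' : Module.Dual F A →ₗ[F] Module.Dual F A →ₗ[F] Module.Dual F A)
    (hA' : IsPreAntiFlexible p' s') :
    IsAntiFlexible (starProd p s p' s') ↔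
      IsPreAntiFlexible (matchedPrec p s p' s') (matchedSucc p s p' s') := by
  refine ⟨fun h => ?_, fun h => ?_⟩
  · exact h.isPreAntiFlexible_of_adjoint (matchedPrec_add_matchedSucc p s p' s')
      (dualPairing F A) dualPairing_separatingLeft
      (dualPairing_matchedPrec p s p' s') (dualPairing_matchedSucc p s p' s')
  · rw [← matchedPrec_add_matchedSucc]
    exact h.isAntiFlexible_add
end

section
/- Let (A,≺,≻) be a finite-dimensional pre-anti-flexible algebra over a field F of characteristic 0 and let r ∈ A⊗A be symmetric, with induced linear map r : A* → A. Then r satisfies the pre-anti-flexible Yang–Baxter equation r23·r12 = r12≺r13 + r13≻r23 if and only if r(a) · r(b) = r(R*≺(r(a))b + L*≻(r(b))a) for all a, b ∈ A*, where x·y = x≺y + x≻y; equivalently, r : A* → A is an O-operator of the underlying anti-flexible algebra aF(A) associated to the bimodule (R*≺, L*≻, A*). -/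
open TensorProduct

/-- The linear map sending `(x⊗y)⊗(z⊗w)` to `z ⊗ (m x w) ⊗ y`; applied to `r ⊗ r` it
yields `r23·r12 = Σ_{i,j} a_j ⊗ (a_i · b_j) ⊗ b_i`. -/
noncomputable def yb1 {F A : Type*} [Field F] [AddCommGroup A] [Module F A]
    (m : A →ₗ[F] A →ₗ[F] A) :
    ((A ⊗[F] A) ⊗[F] (A ⊗[F] A)) →ₗ[F] A ⊗[F] (A ⊗[F] A) :=
  (TensorProduct.map LinearMap.id
      (TensorProduct.map (TensorProduct.lift m) LinearMap.id))
    ∘ₗ (TensorProduct.map LinearMap.id (TensorProduct.assoc F A A A).symm.toLinearMap)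
    ∘ₗ (TensorProduct.assoc F A A (A ⊗[F] A)).toLinearMap
    ∘ₗ (TensorProduct.tensorTensorTensorComm F A A A A).toLinearMap
    ∘ₗ (TensorProduct.comm F (A ⊗[F] A) (A ⊗[F] A)).toLinearMap

/-- The linear map sending `(x⊗y)⊗(z⊗w)` to `(p x z) ⊗ y ⊗ w`; applied to `r ⊗ r` it
yields `r12 ≺ r13 = Σ_{i,j} (a_i ≺ a_j) ⊗ b_i ⊗ b_j`. -/
noncomputable def yb2 {F A : Type*} [Field F] [AddCommGroup A] [Module F A]
    (p : A →ₗ[F] A →ₗ[F] A) :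
    ((A ⊗[F] A) ⊗[F] (A ⊗[F] A)) →ₗ[F] A ⊗[F] (A ⊗[F] A) :=
  (TensorProduct.map (TensorProduct.lift p) LinearMap.id)
    ∘ₗ (TensorProduct.tensorTensorTensorComm F A A A A).toLinearMap

/-- The linear map sending `(x⊗y)⊗(z⊗w)` to `x ⊗ z ⊗ (s y w)`; applied to `r ⊗ r` it
yields `r13 ≻ r23 = Σ_{i,j} a_i ⊗ a_j ⊗ (b_i ≻ b_j)`. -/
noncomputable def yb3 {F A : Type*} [Field F] [AddCommGroup A] [Module F A]
    (s : A →ₗ[F] A →ₗ[F] A) :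
    ((A ⊗[F] A) ⊗[F] (A ⊗[F] A)) →ₗ[F] A ⊗[F] (A ⊗[F] A) :=
  (TensorProduct.assoc F A A A).toLinearMap
    ∘ₗ (TensorProduct.map LinearMap.id (TensorProduct.lift s))
    ∘ₗ (TensorProduct.tensorTensorTensorComm F A A A A).toLinearMap

/-- The pre-anti-flexible Yang–Baxter equation `r23·r12 = r12 ≺ r13 + r13 ≻ r23` for
`r ∈ A ⊗ A`, with product `x·y = p x y + s x y`. -/
noncomputable def IsPAFYBESolution {F A : Type*} [Field F] [AddCommGroup A] [Module F A]
    (p s : A →ₗ[F] A →ₗ[F] A) (r : A ⊗[F] A) : Prop :=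
  yb1 (p + s) (r ⊗ₜ[F] r) = yb2 p (r ⊗ₜ[F] r) + yb3 s (r ⊗ₜ[F] r)

/-- A tensor `r ∈ A ⊗ A` as a linear map `A* → A`, `⟨r(a), b⟩ = ⟨r, a ⊗ b⟩`. -/
noncomputable def rMapL {F A : Type*} [Field F] [AddCommGroup A] [Module F A] :
    (A ⊗[F] A) →ₗ[F] (Module.Dual F A →ₗ[F] A) :=
  (dualTensorHom F (Module.Dual F A) A)
    ∘ₗ (TensorProduct.map (Module.Dual.eval F A) LinearMap.id)

theorem rMapL_tmul {F A : Type*} [Field F] [AddCommGroup A] [Module F A]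
    (x y : A) (a : Module.Dual F A) : rMapL (x ⊗ₜ[F] y) a = a x • y := by
  simp [rMapL]

/-- Contraction of the outer slots of `A ⊗ A ⊗ A`: `x ⊗ y ⊗ z ↦ a x • b z • y`. -/
noncomputable def contractOuter {F A : Type*} [Field F] [AddCommGroup A] [Module F A]
    (a b : Module.Dual F A) : A ⊗[F] (A ⊗[F] A) →ₗ[F] A :=
  (TensorProduct.lid F A).toLinearMap
    ∘ₗ TensorProduct.map a ((TensorProduct.rid F A).toLinearMap
      ∘ₗ TensorProduct.map LinearMap.id b)

theorem contractOuter_tmul {F A : Type*} [Field F] [AddCommGroup A] [Module F A]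
    (a b : Module.Dual F A) (x y z : A) :
    contractOuter a b (x ⊗ₜ[F] (y ⊗ₜ[F] z)) = a x • b z • y := by
  simp [contractOuter, smul_comm (b z)]

theorem eq_of_contractOuter_eq {F A : Type*} [Field F] [AddCommGroup A] [Module F A]
    {t u : A ⊗[F] (A ⊗[F] A)}
    (h : ∀ a b : Module.Dual F A, contractOuter a b t = contractOuter a b u) : t = u := by
  let e := Module.Basis.ofVectorSpace F A
  refine (e.tensorProduct (e.tensorProduct e)).ext_elem fun ⟨i, j, k⟩ => ?_
  have key (v : A ⊗[F] (A ⊗[F] A)) :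
      (e.tensorProduct (e.tensorProduct e)).repr v (i, j, k)
        = e.coord j (contractOuter (e.coord i) (e.coord k) v) := by
    have hmap : (e.tensorProduct (e.tensorProduct e)).coord (i, j, k)
        = e.coord j ∘ₗ contractOuter (e.coord i) (e.coord k) := by
      ext x y z
      simp [contractOuter_tmul, mul_comm]
    exact LinearMap.congr_fun hmap v
  rw [key, key, h]

theorem contractOuter_yb1 {F A : Type*} [Field F] [AddCommGroup A] [Module F A]
    (m : A →ₗ[F] A →ₗ[F] A) (a b : Module.Dual F A) (t u : A ⊗[F] A) :
    contractOuter a b (yb1 m (t ⊗ₜ[F] u))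
      = m (rMapL (TensorProduct.comm F A A t) b) (rMapL u a) := by
  induction t with
  | zero => simp
  | add t t' ht ht' => simp [TensorProduct.add_tmul, ht, ht']
  | tmul x y =>
    induction u with
    | zero => simp
    | add u u' hu hu' => simp only [TensorProduct.tmul_add, map_add, LinearMap.add_apply, hu, hu']
    | tmul z w =>
      simp [yb1, contractOuter_tmul, rMapL_tmul]

theorem contractOuter_yb2 {F A : Type*} [Field F] [AddCommGroup A] [Module F A]
    (p : A →ₗ[F] A →ₗ[F] A) (a b : Module.Dual F A) (t u : A ⊗[F] A) :
    contractOuter a b (yb2 p (t ⊗ₜ[F] u))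
      = rMapL t ((p.flip (rMapL (TensorProduct.comm F A A u) b)).dualMap a) := by
  induction t with
  | zero => simp
  | add t t' ht ht' => simp [TensorProduct.add_tmul, ht, ht']
  | tmul x y =>
    induction u with
    | zero => simp [rMapL_tmul]
    | add u u' hu hu' =>
      rw [TensorProduct.tmul_add, map_add, map_add, hu, hu']
      simp [rMapL_tmul, add_smul]
    | tmul z w =>
      simp [yb2, contractOuter_tmul, rMapL_tmul, smul_smul, mul_comm]

theorem contractOuter_yb3 {F A : Type*} [Field F] [AddCommGroup A] [Module F A]
    (s : A →ₗ[F] A →ₗ[F] A) (a b : Module.Dual F A) (t u : A ⊗[F] A) :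
    contractOuter a b (yb3 s (t ⊗ₜ[F] u))
      = rMapL (TensorProduct.comm F A A u) ((s (rMapL t a)).dualMap b) := by
  induction u with
  | zero => simp
  | add u u' hu hu' => simp [TensorProduct.tmul_add, hu, hu']
  | tmul z w =>
    induction t with
    | zero => simp [rMapL_tmul]
    | add t t' ht ht' =>
      rw [TensorProduct.add_tmul, map_add, map_add, ht, ht']
      simp [rMapL_tmul, add_smul]
    | tmul x y =>
      simp [yb3, contractOuter_tmul, rMapL_tmul, smul_smul]

/-- a symmetric `r` satisfies PAFYBE iff the induced map `r : A* → A` is an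
`O`-operator of the underlying anti-flexible algebra `aF(A)` associated to the bimodule
`(R*≺, L*≻, A*)`, i.e. `r(a)·r(b) = r(R*≺(r(a))b + L*≻(r(b))a)` for all `a, b ∈ A*`. -/
theorem symm_PAFYBE_iff_Ooperator
    {F A : Type*} [Field F] [CharZero F] [AddCommGroup A] [Module F A]
    [FiniteDimensional F A]
    (p s : A →ₗ[F] A →ₗ[F] A) (hA : IsPreAntiFlexible p s)
    (r : A ⊗[F] A) (hsymm : (TensorProduct.comm F A A) r = r) :
    IsPAFYBESolution p s r ↔
      ∀ a b : Module.Dual F A,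
        p (rMapL r a) (rMapL r b) + s (rMapL r a) (rMapL r b)
          = rMapL r ((p.flip (rMapL r a)).dualMap b + (s (rMapL r b)).dualMap a) := by
  have key (a b : Module.Dual F A) :
      contractOuter b a (yb1 (p + s) (r ⊗ₜ[F] r))
          = contractOuter b a (yb2 p (r ⊗ₜ[F] r) + yb3 s (r ⊗ₜ[F] r)) ↔
        p (rMapL r a) (rMapL r b) + s (rMapL r a) (rMapL r b)
          = rMapL r ((p.flip (rMapL r a)).dualMap b + (s (rMapL r b)).dualMap a) := by
    rw [map_add, contractOuter_yb1, contractOuter_yb2, contractOuter_yb3, hsymm, map_add,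
      LinearMap.add_apply, LinearMap.add_apply]
  exact ⟨fun h a b => (key a b).1 (congrArg _ h),
    fun h => eq_of_contractOuter_eq fun b a => (key a b).2 (h a b)⟩
end
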